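/- arXiv:2506.18700 — 3 statements merged into one kernel-verified Lean document; each statement's English description precedes it below -/
import Mathlib

section
/- Let w ∈ C_xy. Then: no z ∈ C_xy adjacent to w is such that the edge wz has type 0; the number of z ∈ C_xy adjacent to w such that the edge wz has type + equals q·[i−1]; and the number of z ∈ C_xy adjacent to w such that the edge wz has type − equals q·[i−1]. -/
open scoped Classical

noncomputable section

variable {F V : Type} [Field F] [AddCommGroup V] [Module F V]

/-- `v` covers `u` in the projective geometry `P`. -/
def Covers (u v : Submodule F V) : Prop :=
  u ≤ v ∧ Module.finrank F ↥v = Module.finrank F ↥u + 1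

/-- `v` slash-covers `u` (relative to the fixed subspace `y`). -/
def SlashCovers (y u v : Submodule F V) : Prop :=
  Covers u v ∧ Module.finrank F ↥(v ⊓ y) = Module.finrank F ↥(u ⊓ y) + 1

/-- `v` backslash-covers `u` (relative to the fixed subspace `y`). -/
def BackslashCovers (y u v : Submodule F V) : Prop :=
  Covers u v ∧ Module.finrank F ↥(v ⊓ y) = Module.finrank F ↥(u ⊓ y)

/-- `q` raised to a real exponent, as a complex number. -/
def qpow (q : ℕ) (e : ℝ) : ℂ := (((q : ℝ) ^ e : ℝ) : ℂ)

/-- The Gaussian bracket `[m] = (q^m - 1)/(q - 1)` as a rational number. -/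
def gaussQ (q m : ℕ) : ℚ := ((q : ℚ) ^ m - 1) / ((q : ℚ) - 1)

/-- The Gaussian bracket `[m] = (q^m - 1)/(q - 1)` as a complex number. -/
def gaussC (q m : ℕ) : ℂ := ((q : ℂ) ^ m - 1) / ((q : ℂ) - 1)

/-- The diagonal matrix `K1`; the `(u,u)` entry is `q^(k/2 - i)` for `u ∈ P_{i,j}`. -/
def matK1 (q k : ℕ) (y : Submodule F V) : Matrix (Submodule F V) (Submodule F V) ℂ :=
  Matrix.diagonal fun u => qpow q ((k : ℝ) / 2 - (Module.finrank F ↥(u ⊓ y) : ℝ))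

/-- The diagonal matrix `K2`; the `(u,u)` entry is `q^(j - (n-k)/2)` for `u ∈ P_{i,j}`. -/
def matK2 (q n k : ℕ) (y : Submodule F V) : Matrix (Submodule F V) (Submodule F V) ℂ :=
  Matrix.diagonal fun u =>
    qpow q (((Module.finrank F ↥u : ℝ) - (Module.finrank F ↥(u ⊓ y) : ℝ))
      - ((n : ℝ) - (k : ℝ)) / 2)

/-- The 0-1 matrix `L1`; the `(u,v)` entry is `1` iff `v` slash-covers `u`. -/
def matL1 (y : Submodule F V) : Matrix (Submodule F V) (Submodule F V) ℂ :=
  Matrix.of fun u v => if SlashCovers y u v then (1 : ℂ) else 0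

/-- The 0-1 matrix `L2`; the `(u,v)` entry is `1` iff `v` backslash-covers `u`. -/
def matL2 (y : Submodule F V) : Matrix (Submodule F V) (Submodule F V) ℂ :=
  Matrix.of fun u v => if BackslashCovers y u v then (1 : ℂ) else 0

/-- `R1 = L1ᵀ`. -/
def matR1 (y : Submodule F V) : Matrix (Submodule F V) (Submodule F V) ℂ := Matrix.transpose (matL1 y)

/-- `R2 = L2ᵀ`. -/
def matR2 (y : Submodule F V) : Matrix (Submodule F V) (Submodule F V) ℂ := Matrix.transpose (matL2 y)

/-- `R = L1 · R2`. -/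
def matR [Fintype (Submodule F V)] (y : Submodule F V) :
    Matrix (Submodule F V) (Submodule F V) ℂ := matL1 y * matR2 y

/-- `L = R1 · L2`. -/
def matL [Fintype (Submodule F V)] (y : Submodule F V) :
    Matrix (Submodule F V) (Submodule F V) ℂ := matR1 y * matL2 y

/-- The 0-1 matrix `F0`. -/
def matF0 (y : Submodule F V) : Matrix (Submodule F V) (Submodule F V) ℂ :=
  Matrix.of fun u v =>
    if SlashCovers y u (u ⊔ v) ∧ SlashCovers y v (u ⊔ v) ∧
        BackslashCovers y (u ⊓ v) u ∧ BackslashCovers y (u ⊓ v) v then (1 : ℂ) else 0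

/-- The 0-1 matrix `F+`. -/
def matFp (y : Submodule F V) : Matrix (Submodule F V) (Submodule F V) ℂ :=
  Matrix.of fun u v =>
    if BackslashCovers y u (u ⊔ v) ∧ BackslashCovers y v (u ⊔ v) then (1 : ℂ) else 0

/-- The 0-1 matrix `F-`. -/
def matFm (y : Submodule F V) : Matrix (Submodule F V) (Submodule F V) ℂ :=
  Matrix.of fun u v =>
    if SlashCovers y (u ⊓ v) u ∧ SlashCovers y (u ⊓ v) v then (1 : ℂ) else 0

/-- The vertex set `X` of the Grassmann graph: `k`-dimensional subspaces of `V`. -/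
abbrev GrassVertex (F V : Type) [Field F] [AddCommGroup V] [Module F V] (k : ℕ) :=
  {z : Submodule F V // Module.finrank F ↥z = k}

/-- The Grassmann graph `J_q(n,k)`: vertices are adjacent iff their intersection
has dimension `k - 1`. -/
def Grass (F V : Type) [Field F] [AddCommGroup V] [Module F V] (k : ℕ) :
    SimpleGraph (GrassVertex F V k) :=
  SimpleGraph.fromRel fun a b => Module.finrank F ↥(a.1 ⊓ b.1) = k - 1

/-- `B_xy = {z ∈ Γ(x) : ∂(z,y) = ∂(x,y) + 1}`. -/
def Bset {k : ℕ} (x y : GrassVertex F V k) : Set (GrassVertex F V k) :=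
  {z | (Grass F V k).Adj x z ∧ (Grass F V k).dist z y = (Grass F V k).dist x y + 1}

/-- `C_xy = {z ∈ Γ(x) : ∂(z,y) = ∂(x,y) - 1}`. -/
def Cset {k : ℕ} (x y : GrassVertex F V k) : Set (GrassVertex F V k) :=
  {z | (Grass F V k).Adj x z ∧ (Grass F V k).dist z y = (Grass F V k).dist x y - 1}

/-- `A_xy = {z ∈ Γ(x) : ∂(z,y) = ∂(x,y)}`. -/
def Aset {k : ℕ} (x y : GrassVertex F V k) : Set (GrassVertex F V k) :=
  {z | (Grass F V k).Adj x z ∧ (Grass F V k).dist z y = (Grass F V k).dist x y}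

/-- `A0_xy`. -/
def A0set {k : ℕ} (x y : GrassVertex F V k) : Set (GrassVertex F V k) :=
  {z | (Grass F V k).Adj x z ∧
    SlashCovers y.1 z.1 (z.1 ⊔ x.1) ∧ SlashCovers y.1 x.1 (z.1 ⊔ x.1) ∧
    BackslashCovers y.1 (z.1 ⊓ x.1) z.1 ∧ BackslashCovers y.1 (z.1 ⊓ x.1) x.1}

/-- `A+_xy`. -/
def Apset {k : ℕ} (x y : GrassVertex F V k) : Set (GrassVertex F V k) :=
  {z | (Grass F V k).Adj x z ∧
    BackslashCovers y.1 z.1 (z.1 ⊔ x.1) ∧ BackslashCovers y.1 x.1 (z.1 ⊔ x.1)}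

/-- `A-_xy`. -/
def Amset {k : ℕ} (x y : GrassVertex F V k) : Set (GrassVertex F V k) :=
  {z | (Grass F V k).Adj x z ∧
    SlashCovers y.1 (z.1 ⊓ x.1) z.1 ∧ SlashCovers y.1 (z.1 ⊓ x.1) x.1}

/-- The edge `wz` has type `0`. -/
def EdgeType0 {k : ℕ} (y w z : GrassVertex F V k) : Prop :=
  SlashCovers y.1 w.1 (w.1 ⊔ z.1) ∧ SlashCovers y.1 z.1 (w.1 ⊔ z.1) ∧
  BackslashCovers y.1 (w.1 ⊓ z.1) w.1 ∧ BackslashCovers y.1 (w.1 ⊓ z.1) z.1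

/-- The edge `wz` has type `+`. -/
def EdgeTypeP {k : ℕ} (y w z : GrassVertex F V k) : Prop :=
  BackslashCovers y.1 w.1 (w.1 ⊔ z.1) ∧ BackslashCovers y.1 z.1 (w.1 ⊔ z.1)

/-- The edge `wz` has type `-`. -/
def EdgeTypeM {k : ℕ} (y w z : GrassVertex F V k) : Prop :=
  SlashCovers y.1 (w.1 ⊓ z.1) w.1 ∧ SlashCovers y.1 (w.1 ⊓ z.1) z.1

open Module

section Subspaces

variable [FiniteDimensional F V]

lemma finrank_sup_inf (a b : Submodule F V) :
    finrank F ↥(a ⊔ b) + finrank F ↥(a ⊓ b) = finrank F a + finrank F b :=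
  Submodule.finrank_sup_add_finrank_inf_eq a b

lemma exists_le_le_finrank_eq {a b : Submodule F V} (hab : a ≤ b) {d : ℕ}
    (h₁ : finrank F a ≤ d) (h₂ : d ≤ finrank F b) :
    ∃ c : Submodule F V, a ≤ c ∧ c ≤ b ∧ finrank F c = d := by
  induction d, h₁ using Nat.le_induction with
  | base => exact ⟨a, le_rfl, hab, rfl⟩
  | succ d _ ih =>
    obtain ⟨c, hac, hcb, hc⟩ := ih (by omega)
    have hne : ¬ b ≤ c := fun hbc => by
      have := Submodule.finrank_mono hbc
      omega
    obtain ⟨v, hvb, hvc⟩ := SetLike.not_le_iff_exists.1 hne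
    refine ⟨c ⊔ Submodule.span F {v}, hac.trans le_sup_left, sup_le hcb (by simpa using hvb), ?_⟩
    have hlt : c < c ⊔ Submodule.span F {v} := by simpa using hvc
    have h₃ := Submodule.finrank_lt_finrank_of_lt hlt
    have h₄ := finrank_sup_inf c (Submodule.span F {v})
    have h₅ : finrank F (Submodule.span F {v}) ≤ 1 := by
      simpa using finrank_span_le_card (R := F) ({v} : Set V)
    omega

/-- Lines of a space are counted by a geometric sum. -/
lemma ncard_finrank_eq_one [Finite F] {W : Type*} [AddCommGroup W] [Module F W] :
    {s : Submodule F W | finrank F s = 1}.ncard =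
      ∑ j ∈ Finset.range (finrank F W), Nat.card F ^ j := by
  rw [← Projectivization.card_of_finrank F W rfl, Nat.card_congr (Projectivization.equivSubmodule F W)]
  rfl

/-- Hyperplanes of a space are counted by a geometric sum. -/
lemma ncard_finrank_add_one_eq [Finite F] {W : Type*} [AddCommGroup W] [Module F W]
    [FiniteDimensional F W] :
    {s : Submodule F W | finrank F s + 1 = finrank F W}.ncard =
      ∑ j ∈ Finset.range (finrank F W), Nat.card F ^ j := by
  rw [← Subspace.dual_finrank_eq (K := F) (V := W), ← ncard_finrank_eq_one (W := Dual F W),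
    Subspace.dual_finrank_eq]
  refine Set.ncard_congr (fun s _ => s.dualAnnihilator) ?_ ?_ ?_
  · intro s hs
    have := Subspace.finrank_add_finrank_dualAnnihilator_eq s
    simp only [Set.mem_ofPred_eq] at hs ⊢
    omega
  · intro s t _ _ h
    exact Subspace.dualAnnihilator_inj.1 h
  · intro t ht
    refine ⟨t.dualCoannihilator, ?_, Subspace.dualCoannihilator_dualAnnihilator_eq⟩
    have := Subspace.finrank_add_finrank_dualCoannihilator_eq t
    simp only [Set.mem_ofPred_eq] at ht ⊢
    omega

/-- Subspaces of `b / a` correspond to the subspaces between `a` and `b`. -/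
lemma ncard_between {a b : Submodule F V} (hab : a ≤ b) (r : ℕ) :
    {l : Submodule F V | a ≤ l ∧ l ≤ b ∧ finrank F l = finrank F a + r}.ncard =
      {s : Submodule F (b ⧸ a.submoduleOf b) | finrank F s = r}.ncard := by
  have hfin (s : Submodule F (b ⧸ a.submoduleOf b)) :
      finrank F ↥((s.comap (a.submoduleOf b).mkQ).map b.subtype) = finrank F a + r ↔
        finrank F s = r := by
    have h₁ := ((a.submoduleOf b).mkQ.domRestrict (s.comap (a.submoduleOf b).mkQ)
      ).finrank_range_add_finrank_ker
    rw [LinearMap.range_domRestrict, Submodule.map_comap_eq_of_surjective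
      (Submodule.mkQ_surjective _), LinearMap.ker_domRestrict, Submodule.ker_mkQ] at h₁
    have h₂ := (Submodule.submoduleOfEquivOfLe
      (Submodule.le_comap_mkQ (a.submoduleOf b) s)).finrank_eq
    have h₃ := (Submodule.submoduleOfEquivOfLe hab).finrank_eq
    rw [Submodule.finrank_map_subtype_eq]
    change finrank F s + finrank F ↥((a.submoduleOf b).submoduleOf _) = _ at h₁
    omega
  symm
  refine Set.ncard_congr (fun s _ => (s.comap (a.submoduleOf b).mkQ).map b.subtype) ?_ ?_ ?_
  · intro s hs
    refine ⟨?_, Submodule.map_subtype_le _ _, (hfin s).2 hs⟩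
    calc a = (a.submoduleOf b).map b.subtype := by
          rw [Submodule.submoduleOf, Submodule.map_comap_subtype, inf_eq_right.2 hab]
      _ ≤ _ := Submodule.map_mono (Submodule.le_comap_mkQ _ s)
  · intro s t _ _ h
    exact Submodule.comap_injective_of_surjective (Submodule.mkQ_surjective _)
      (Submodule.map_injective_of_injective b.injective_subtype h)
  · rintro l ⟨hal, hlb, hl⟩
    have key : (((l.submoduleOf b).map (a.submoduleOf b).mkQ).comap
        (a.submoduleOf b).mkQ).map b.subtype = l := by
      rw [Submodule.comap_map_mkQ, sup_eq_right.2 (Submodule.comap_mono hal),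
        Submodule.submoduleOf, Submodule.map_comap_subtype, inf_eq_right.2 hlb]
    exact ⟨_, (hfin _).1 (by rw [key]; exact hl), key⟩

lemma finrank_quotient_submoduleOf {a b : Submodule F V} (hab : a ≤ b) :
    finrank F (b ⧸ a.submoduleOf b) + finrank F a = finrank F b := by
  rw [← (Submodule.submoduleOfEquivOfLe hab).finrank_eq, Submodule.finrank_quotient_add_finrank]

lemma ncard_between_succ [Finite F] {a b : Submodule F V} (hab : a ≤ b) {m : ℕ}
    (hm : finrank F b = finrank F a + m) :
    {l : Submodule F V | a ≤ l ∧ l ≤ b ∧ finrank F l = finrank F a + 1}.ncard =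
      ∑ j ∈ Finset.range m, Nat.card F ^ j := by
  have := finrank_quotient_submoduleOf hab
  rw [ncard_between hab, ncard_finrank_eq_one, show finrank F (b ⧸ a.submoduleOf b) = m by omega]

lemma ncard_between_pred [Finite F] {a b : Submodule F V} (hab : a ≤ b) {m : ℕ}
    (hm : finrank F b = finrank F a + m) (hpos : 0 < m) :
    {h : Submodule F V | a ≤ h ∧ h ≤ b ∧ finrank F h + 1 = finrank F b}.ncard =
      ∑ j ∈ Finset.range m, Nat.card F ^ j := by
  have hq := finrank_quotient_submoduleOf hab
  have hW : finrank F (b ⧸ a.submoduleOf b) = m := by omega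
  have h₁ : {h : Submodule F V | a ≤ h ∧ h ≤ b ∧ finrank F h + 1 = finrank F b} =
      {l : Submodule F V | a ≤ l ∧ l ≤ b ∧ finrank F l = finrank F a + (m - 1)} := by
    ext h
    simp only [Set.mem_ofPred_eq]
    refine and_congr_right fun _ => and_congr_right fun _ => ?_
    omega
  have h₂ : {s : Submodule F (b ⧸ a.submoduleOf b) | finrank F s = m - 1} =
      {s : Submodule F (b ⧸ a.submoduleOf b) |
        finrank F s + 1 = finrank F (b ⧸ a.submoduleOf b)} := by
    ext s
    simp only [Set.mem_ofPred_eq]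
    omega
  rw [h₁, ncard_between hab, h₂, ncard_finrank_add_one_eq, hW]

end Subspaces

section Closer

variable [FiniteDimensional F V] {k i : ℕ}

/-- `z` is a neighbour of `x` one step closer to `y`, where `x` is at distance `i` from `y`. -/
structure IsCloser (k i : ℕ) (x y z : Submodule F V) : Prop where
  finrank_left : finrank F x = k
  finrank_base : finrank F ↥(x ⊓ y) + i = k
  finrank_eq : finrank F z = k
  finrank_inf_left : finrank F ↥(x ⊓ z) + 1 = k
  finrank_inf_base : finrank F ↥(z ⊓ y) + i = k + 1

namespace IsCloser

variable {x y z w : Submodule F V}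

lemma base_le (hz : IsCloser k i x y z) : x ⊓ y ≤ z := by
  obtain ⟨h₁, h₂, h₃, h₄, h₅⟩ := hz
  have h₆ := finrank_sup_inf (x ⊓ z) (z ⊓ y)
  have h₇ : finrank F ↥(x ⊓ z ⊔ z ⊓ y) ≤ finrank F z :=
    Submodule.finrank_mono (sup_le inf_le_right inf_le_left)
  have h₈ : x ⊓ z ⊓ (z ⊓ y) = x ⊓ y :=
    Submodule.eq_of_le_of_finrank_le (inf_le_inf inf_le_left inf_le_right) (by omega)
  rw [← h₈]
  exact inf_le_left.trans inf_le_right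

lemma inf_inf_base (hz : IsCloser k i x y z) : x ⊓ z ⊓ y = x ⊓ y :=
  le_antisymm (inf_le_inf_right _ inf_le_left)
    (le_inf (le_inf inf_le_left hz.base_le) inf_le_right)

lemma sup_eq (hz : IsCloser k i x y z) : (x ⊓ z) ⊔ (z ⊓ y) = z := by
  have h₆ := finrank_sup_inf (x ⊓ z) (z ⊓ y)
  have h₈ : x ⊓ z ⊓ (z ⊓ y) = x ⊓ y := by
    rw [← inf_assoc, inf_assoc x z z, inf_idem, hz.inf_inf_base]
  rw [h₈] at h₆
  obtain ⟨h₁, h₂, h₃, h₄, h₅⟩ := hz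
  exact Submodule.eq_of_le_of_finrank_le (sup_le inf_le_right inf_le_left) (by omega)

lemma eq_of_inf_eq (hw : IsCloser k i x y w) (hz : IsCloser k i x y z)
    (h₁ : x ⊓ w = x ⊓ z) (h₂ : w ⊓ y = z ⊓ y) : w = z := by
  rw [← hw.sup_eq, ← hz.sup_eq, h₁, h₂]

lemma finrank_sup_base (hz : IsCloser k i x y z) : finrank F ↥(x ⊔ z ⊓ y) = k + 1 := by
  have h₆ := finrank_sup_inf x (z ⊓ y)
  have h₇ : x ⊓ (z ⊓ y) = x ⊓ y := by rw [← inf_assoc, hz.inf_inf_base]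
  rw [h₇] at h₆
  obtain ⟨h₁, h₂, h₃, h₄, h₅⟩ := hz
  omega

lemma le_sup_base (hz : IsCloser k i x y z) : z ≤ x ⊔ z ⊓ y := by
  conv_lhs => rw [← hz.sup_eq]
  exact sup_le_sup_right inf_le_left _

lemma sup_base_inf (hz : IsCloser k i x y z) : (x ⊔ z ⊓ y) ⊓ y = z ⊓ y := by
  rw [sup_comm, sup_inf_assoc_of_le _ inf_le_right, sup_eq_left]
  exact le_inf hz.base_le inf_le_right

/-- Two neighbours with the same trace on `y` span `x` together with that trace. -/
lemma sup_eq_sup_base (hw : IsCloser k i x y w) (hz : IsCloser k i x y z)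
    (h : w ⊓ y = z ⊓ y) (hne : w ≠ z) : w ⊔ z = x ⊔ w ⊓ y := by
  refine Submodule.eq_of_le_of_finrank_le (sup_le hw.le_sup_base (h ▸ hz.le_sup_base)) ?_
  rw [hw.finrank_sup_base]
  have hlt : w < w ⊔ z := by
    refine lt_of_le_of_ne le_sup_left fun h' => hne ?_
    exact (Submodule.eq_of_le_of_finrank_le (le_sup_right.trans_eq h'.symm)
      (by rw [hw.finrank_eq, hz.finrank_eq])).symm
  have := Submodule.finrank_lt_finrank_of_lt hlt
  rw [hw.finrank_eq] at this
  omega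

/-- Two neighbours with the same trace on `x` meet in that trace. -/
lemma inf_eq_inf_left (hw : IsCloser k i x y w) (hz : IsCloser k i x y z)
    (h : x ⊓ w = x ⊓ z) (hne : w ≠ z) : w ⊓ z = x ⊓ w := by
  symm
  refine Submodule.eq_of_le_of_finrank_le (le_inf inf_le_right (h ▸ inf_le_right)) ?_
  have hlt : w ⊓ z < w := by
    refine lt_of_le_of_ne inf_le_left fun h' => hne ?_
    exact Submodule.eq_of_le_of_finrank_le (inf_eq_left.1 h')
      (by rw [hw.finrank_eq, hz.finrank_eq])
  have h₁ := Submodule.finrank_lt_finrank_of_lt hlt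
  have h₂ := hw.finrank_inf_left
  rw [hw.finrank_eq] at h₁
  omega

/-- Adjacent neighbours share their trace on `x` or their trace on `y`. -/
lemma inf_eq_or_inf_eq (hw : IsCloser k i x y w) (hz : IsCloser k i x y z)
    (h : finrank F ↥(w ⊓ z) + 1 = k) : x ⊓ w = x ⊓ z ∨ w ⊓ y = z ⊓ y := by
  refine or_iff_not_imp_left.2 fun hne => ?_
  have hx : x ⊓ w ⊔ x ⊓ z = x := by
    refine Submodule.eq_of_le_of_finrank_le (sup_le inf_le_left inf_le_left) ?_
    have hlt : x ⊓ w < x ⊓ w ⊔ x ⊓ z := by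
      refine lt_of_le_of_ne le_sup_left fun h' => hne ?_
      refine (Submodule.eq_of_le_of_finrank_le (le_sup_right.trans_eq h'.symm) ?_).symm
      have := hw.finrank_inf_left
      have := hz.finrank_inf_left
      omega
    have h₁ := Submodule.finrank_lt_finrank_of_lt hlt
    have h₂ := hw.finrank_inf_left
    rw [hw.finrank_left]
    omega
  have hxle : x ≤ w ⊔ z := by
    conv_lhs => rw [← hx]
    exact sup_le_sup inf_le_right inf_le_right
  have hdim := finrank_sup_inf w z
  rw [hw.finrank_eq, hz.finrank_eq] at hdim
  have h₁ : x ⊔ w ⊓ y = w ⊔ z :=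
    Submodule.eq_of_le_of_finrank_le (sup_le hxle (inf_le_left.trans le_sup_left))
      (by rw [hw.finrank_sup_base]; omega)
  have h₂ : x ⊔ z ⊓ y = w ⊔ z :=
    Submodule.eq_of_le_of_finrank_le (sup_le hxle (inf_le_left.trans le_sup_right))
      (by rw [hz.finrank_sup_base]; omega)
  rw [← hw.sup_base_inf, ← hz.sup_base_inf, h₁, h₂]

/-- A hyperplane of `x` and a one-step extension of `x ⊓ y` in `y` combine to a neighbour. -/
lemma of_sup {h l : Submodule F V} (hx : finrank F x = k) (hxy : finrank F ↥(x ⊓ y) + i = k)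
    (hah : x ⊓ y ≤ h) (hhx : h ≤ x) (hh : finrank F h + 1 = k)
    (hal : x ⊓ y ≤ l) (hly : l ≤ y) (hl : finrank F l + i = k + 1) :
    IsCloser k i x y (h ⊔ l) ∧ x ⊓ (h ⊔ l) = h ∧ (h ⊔ l) ⊓ y = l := by
  have hlx : l ⊓ x = x ⊓ y :=
    le_antisymm (le_inf inf_le_right (inf_le_left.trans hly)) (le_inf hal inf_le_left)
  have hhl : h ⊓ l = x ⊓ y := le_antisymm (inf_le_inf hhx hly) (le_inf hah hal)
  have hhy : h ⊓ y = x ⊓ y :=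
    le_antisymm (inf_le_inf_right _ hhx) (le_inf hah inf_le_right)
  have hdim := finrank_sup_inf h l
  rw [hhl] at hdim
  have hxz : x ⊓ (h ⊔ l) = h := by
    rw [inf_comm, sup_inf_assoc_of_le _ hhx, hlx, sup_eq_left.2 hah]
  have hzy : (h ⊔ l) ⊓ y = l := by
    rw [sup_comm, sup_inf_assoc_of_le _ hly, hhy, sup_eq_left.2 hal]
  exact ⟨⟨hx, hxy, by omega, by rw [hxz, hh], by rw [hzy, hl]⟩, hxz, hzy⟩

end IsCloser

end Closer

section Distance

variable {k : ℕ}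

lemma grass_adj_iff (hk : 0 < k) {x z : GrassVertex F V k} :
    (Grass F V k).Adj x z ↔ finrank F ↥(x.1 ⊓ z.1) + 1 = k := by
  rw [Grass, SimpleGraph.fromRel_adj, inf_comm z.1 x.1, or_self]
  constructor
  · rintro ⟨-, h⟩
    omega
  · intro h
    refine ⟨?_, by omega⟩
    rintro rfl
    rw [inf_idem, x.2] at h
    omega

variable [FiniteDimensional F V]

lemma le_finrank_inf_add_length (hk : 0 < k) {x y : GrassVertex F V k}
    (p : (Grass F V k).Walk x y) : k ≤ finrank F ↥(x.1 ⊓ y.1) + p.length := by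
  induction p with
  | @nil x => rw [inf_idem, x.2]; omega
  | @cons x z y hxz p ih =>
    rw [grass_adj_iff hk] at hxz
    have h₁ := finrank_sup_inf (x.1 ⊓ z.1) (z.1 ⊓ y.1)
    have h₂ : finrank F ↥(x.1 ⊓ z.1 ⊔ z.1 ⊓ y.1) ≤ finrank F z.1 :=
      Submodule.finrank_mono (sup_le inf_le_right inf_le_left)
    have h₃ : finrank F ↥(x.1 ⊓ z.1 ⊓ (z.1 ⊓ y.1)) ≤ finrank F ↥(x.1 ⊓ y.1) :=
      Submodule.finrank_mono (inf_le_inf inf_le_left inf_le_right)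
    rw [z.2] at h₂
    rw [SimpleGraph.Walk.length_cons]
    omega

lemma exists_walk_length_eq (hk : 0 < k) (d : ℕ) (x y : GrassVertex F V k)
    (hd : finrank F ↥(x.1 ⊓ y.1) + d = k) : ∃ p : (Grass F V k).Walk x y, p.length = d := by
  induction d generalizing x with
  | zero =>
    have h₁ : x.1 ⊓ y.1 = x.1 :=
      Submodule.eq_of_le_of_finrank_le inf_le_left (by rw [x.2]; omega)
    have h₂ : x.1 ⊓ y.1 = y.1 :=
      Submodule.eq_of_le_of_finrank_le inf_le_right (by rw [y.2]; omega)
    obtain rfl : x = y := Subtype.ext (h₁.symm.trans h₂)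
    exact ⟨.nil, rfl⟩
  | succ d ih =>
    obtain ⟨h, hah, hhx, hh⟩ := exists_le_le_finrank_eq (d := k - 1)
      (inf_le_left : x.1 ⊓ y.1 ≤ x.1) (by omega) (by rw [x.2]; omega)
    obtain ⟨l, hal, hly, hl⟩ := exists_le_le_finrank_eq (d := finrank F ↥(x.1 ⊓ y.1) + 1)
      (inf_le_right : x.1 ⊓ y.1 ≤ y.1) (by omega) (by rw [y.2]; omega)
    obtain ⟨hz, hxz, hzy⟩ := IsCloser.of_sup x.2 hd hah hhx (by omega) hal hly (by omega)
    let z : GrassVertex F V k := ⟨h ⊔ l, hz.finrank_eq⟩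
    have hadj : (Grass F V k).Adj x z := by
      rw [grass_adj_iff hk, hxz]
      omega
    obtain ⟨p, hp⟩ := ih z (by rw [hzy]; omega)
    exact ⟨.cons hadj p, by simp [hp]⟩

/-- The distance in the Grassmann graph is the codimension of the intersection. -/
lemma grass_dist_add (hk : 0 < k) (x y : GrassVertex F V k) :
    finrank F ↥(x.1 ⊓ y.1) + (Grass F V k).dist x y = k := by
  have hle : finrank F ↥(x.1 ⊓ y.1) ≤ k :=
    (Submodule.finrank_mono inf_le_left).trans_eq x.2
  obtain ⟨p, hp⟩ := exists_walk_length_eq hk (k - finrank F ↥(x.1 ⊓ y.1)) x y (by omega)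
  obtain ⟨p', hp'⟩ := p.reachable.exists_walk_length_eq_dist
  have h₁ := SimpleGraph.dist_le p
  have h₂ := le_finrank_inf_add_length hk p'
  omega

lemma mem_Cset_iff {i : ℕ} (hk : 0 < k) (hi : 0 < i) {x y z : GrassVertex F V k}
    (hxy : (Grass F V k).dist x y = i) : z ∈ Cset x y ↔ IsCloser k i x.1 y.1 z.1 := by
  have h₁ := grass_dist_add hk x y
  have h₂ := grass_dist_add hk z y
  simp only [Cset, Set.mem_ofPred_eq, grass_adj_iff hk]
  rw [hxy] at h₁ ⊢
  constructor
  · rintro ⟨h₃, h₄⟩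
    exact ⟨x.2, h₁, z.2, h₃, by omega⟩
  · intro h
    have := h.finrank_inf_base
    exact ⟨h.finrank_inf_left, by omega⟩

end Distance

section Edges

variable [FiniteDimensional F V] {k i : ℕ} {x y w z : GrassVertex F V k}

lemma adj_and_edgeTypeP_iff (hk : 0 < k) (hw : IsCloser k i x.1 y.1 w.1)
    (hz : IsCloser k i x.1 y.1 z.1) :
    (Grass F V k).Adj w z ∧ EdgeTypeP y w z ↔ w.1 ⊓ y.1 = z.1 ⊓ y.1 ∧ w.1 ≠ z.1 := by
  constructor
  · rintro ⟨hadj, ⟨-, h₁⟩, -, h₂⟩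
    refine ⟨?_, fun h => hadj.ne (Subtype.ext h)⟩
    have e₁ : w.1 ⊓ y.1 = (w.1 ⊔ z.1) ⊓ y.1 :=
      Submodule.eq_of_le_of_finrank_le (inf_le_inf_right _ le_sup_left) h₁.le
    have e₂ : z.1 ⊓ y.1 = (w.1 ⊔ z.1) ⊓ y.1 :=
      Submodule.eq_of_le_of_finrank_le (inf_le_inf_right _ le_sup_right) h₂.le
    rw [e₁, e₂]
  · rintro ⟨h, hne⟩
    have hsup := hw.sup_eq_sup_base hz h hne
    have hdim := finrank_sup_inf w.1 z.1
    have hs := hw.finrank_sup_base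
    rw [← hsup] at hs
    have hb : (w.1 ⊔ z.1) ⊓ y.1 = w.1 ⊓ y.1 := by rw [hsup, hw.sup_base_inf]
    rw [hw.finrank_eq, hz.finrank_eq] at hdim
    refine ⟨(grass_adj_iff hk).2 (by omega), ⟨⟨le_sup_left, ?_⟩, ?_⟩, ⟨le_sup_right, ?_⟩, ?_⟩
    · rw [hs, hw.finrank_eq]
    · rw [hb]
    · rw [hs, hz.finrank_eq]
    · rw [hb, h]

lemma adj_and_edgeTypeM_iff (hk : 0 < k) (hw : IsCloser k i x.1 y.1 w.1)
    (hz : IsCloser k i x.1 y.1 z.1) :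
    (Grass F V k).Adj w z ∧ EdgeTypeM y w z ↔ x.1 ⊓ w.1 = x.1 ⊓ z.1 ∧ w.1 ≠ z.1 := by
  constructor
  · rintro ⟨hadj, ⟨-, h₁⟩, -, h₂⟩
    refine ⟨?_, fun h => hadj.ne (Subtype.ext h)⟩
    refine (hw.inf_eq_or_inf_eq hz ((grass_adj_iff hk).1 hadj)).resolve_right fun h => ?_
    have : w.1 ⊓ y.1 ≤ w.1 ⊓ z.1 ⊓ y.1 :=
      le_inf (le_inf inf_le_left (h ▸ inf_le_left)) inf_le_right
    have := Submodule.finrank_mono this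
    omega
  · rintro ⟨h, hne⟩
    have hinf := hw.inf_eq_inf_left hz h hne
    have h₁ := hw.finrank_inf_left
    have h₂ := hw.finrank_base
    have h₃ := hw.finrank_inf_base
    have h₄ := hz.finrank_inf_base
    have hb : w.1 ⊓ z.1 ⊓ y.1 = x.1 ⊓ y.1 := by rw [hinf, hw.inf_inf_base]
    refine ⟨(grass_adj_iff hk).2 (by rw [hinf, h₁]), ⟨⟨inf_le_left, ?_⟩, ?_⟩,
      ⟨inf_le_right, ?_⟩, ?_⟩
    · rw [hinf, h₁, hw.finrank_eq]
    · rw [hb]; omega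
    · rw [hinf, h₁, hz.finrank_eq]
    · rw [hb]; omega

lemma not_edgeType0 (hk : 0 < k) (hw : IsCloser k i x.1 y.1 w.1)
    (hz : IsCloser k i x.1 y.1 z.1) (hadj : (Grass F V k).Adj w z) : ¬ EdgeType0 y w z := by
  rintro ⟨⟨-, h₁⟩, -, ⟨-, h₂⟩, -⟩
  have hne : w.1 ≠ z.1 := fun h => hadj.ne (Subtype.ext h)
  rcases hw.inf_eq_or_inf_eq hz ((grass_adj_iff hk).1 hadj) with h | h
  · obtain ⟨-, ⟨-, h₃⟩, -⟩ := (adj_and_edgeTypeM_iff hk hw hz).2 ⟨h, hne⟩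
    omega
  · obtain ⟨-, ⟨-, h₃⟩, -⟩ := (adj_and_edgeTypeP_iff hk hw hz).2 ⟨h, hne⟩
    omega

variable [Finite F]

lemma ncard_edgeTypeP (hk : 0 < k) (hi : 0 < i) (hxy : (Grass F V k).dist x y = i)
    (hw : IsCloser k i x.1 y.1 w.1) :
    {z | z ∈ Cset x y ∧ (Grass F V k).Adj w z ∧ EdgeTypeP y w z}.ncard + 1 =
      ∑ j ∈ Finset.range i, Nat.card F ^ j := by
  have hS : {z | z ∈ Cset x y ∧ (Grass F V k).Adj w z ∧ EdgeTypeP y w z} =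
      {z | IsCloser k i x.1 y.1 z.1 ∧ w.1 ⊓ y.1 = z.1 ⊓ y.1 ∧ w.1 ≠ z.1} := by
    ext z
    simp only [Set.mem_ofPred_eq, mem_Cset_iff hk hi hxy]
    exact and_congr_right fun hz => adj_and_edgeTypeP_iff hk hw hz
  have hbase := hw.finrank_base
  set A := {h : Submodule F V | x.1 ⊓ y.1 ≤ h ∧ h ≤ x.1 ∧ finrank F h + 1 = finrank F x.1}
  have hA : A.ncard = ∑ j ∈ Finset.range i, Nat.card F ^ j :=
    ncard_between_pred inf_le_left (by rw [x.2, hbase]) hi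
  have hApos : A.ncard ≠ 0 := by
    rw [hA]
    obtain ⟨m, rfl⟩ := Nat.exists_eq_add_of_lt hi
    simp [Finset.sum_range_succ']
  have hwA : x.1 ⊓ w.1 ∈ A :=
    ⟨le_inf inf_le_left hw.base_le, inf_le_left, by rw [hw.finrank_inf_left, x.2]⟩
  rw [hS, ← hA, ← Set.ncard_sdiff_singleton_add_one hwA (Set.finite_of_ncard_ne_zero hApos),
    Nat.add_right_cancel_iff]
  refine Set.ncard_congr (fun z _ => x.1 ⊓ z.1) ?_ ?_ ?_
  · rintro z ⟨hz, h, hne⟩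
    refine ⟨⟨le_inf inf_le_left hz.base_le, inf_le_left, ?_⟩, fun h' => ?_⟩
    · rw [hz.finrank_inf_left, x.2]
    · exact hne (hw.eq_of_inf_eq hz (Set.mem_singleton_iff.1 h').symm h)
  · rintro z z' ⟨hz, h, -⟩ ⟨hz', h', -⟩ heq
    exact Subtype.ext (hz.eq_of_inf_eq hz' heq (h.symm.trans h'))
  · rintro h ⟨⟨hah, hhx, hh⟩, hne⟩
    obtain ⟨hz, h₁, h₂⟩ := IsCloser.of_sup x.2 hbase hah hhx (by rw [hh, x.2])
      (le_inf hw.base_le inf_le_right) inf_le_right hw.finrank_inf_base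
    refine ⟨⟨_, hz.finrank_eq⟩, ⟨hz, h₂.symm, fun h' => hne ?_⟩, h₁⟩
    exact h₁.symm.trans (congrArg (x.1 ⊓ ·) h'.symm)

lemma ncard_edgeTypeM (hk : 0 < k) (hi : 0 < i) (hxy : (Grass F V k).dist x y = i)
    (hw : IsCloser k i x.1 y.1 w.1) :
    {z | z ∈ Cset x y ∧ (Grass F V k).Adj w z ∧ EdgeTypeM y w z}.ncard + 1 =
      ∑ j ∈ Finset.range i, Nat.card F ^ j := by
  have hS : {z | z ∈ Cset x y ∧ (Grass F V k).Adj w z ∧ EdgeTypeM y w z} =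
      {z | IsCloser k i x.1 y.1 z.1 ∧ x.1 ⊓ w.1 = x.1 ⊓ z.1 ∧ w.1 ≠ z.1} := by
    ext z
    simp only [Set.mem_ofPred_eq, mem_Cset_iff hk hi hxy]
    exact and_congr_right fun hz => adj_and_edgeTypeM_iff hk hw hz
  have hbase := hw.finrank_base
  set B := {l : Submodule F V |
    x.1 ⊓ y.1 ≤ l ∧ l ≤ y.1 ∧ finrank F l = finrank F ↥(x.1 ⊓ y.1) + 1}
  have hB : B.ncard = ∑ j ∈ Finset.range i, Nat.card F ^ j :=
    ncard_between_succ inf_le_right (by rw [y.2, hbase])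
  have hBpos : B.ncard ≠ 0 := by
    rw [hB]
    obtain ⟨m, rfl⟩ := Nat.exists_eq_add_of_lt hi
    simp [Finset.sum_range_succ']
  have mem_B {z : GrassVertex F V k} (hz : IsCloser k i x.1 y.1 z.1) : z.1 ⊓ y.1 ∈ B := by
    refine ⟨le_inf hz.base_le inf_le_right, inf_le_right, ?_⟩
    have := hz.finrank_inf_base
    omega
  rw [hS, ← hB, ← Set.ncard_sdiff_singleton_add_one (mem_B hw)
    (Set.finite_of_ncard_ne_zero hBpos), Nat.add_right_cancel_iff]
  refine Set.ncard_congr (fun z _ => z.1 ⊓ y.1) ?_ ?_ ?_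
  · rintro z ⟨hz, h, hne⟩
    exact ⟨mem_B hz, fun h' => hne (hw.eq_of_inf_eq hz h (Set.mem_singleton_iff.1 h').symm)⟩
  · rintro z z' ⟨hz, h, -⟩ ⟨hz', h', -⟩ heq
    exact Subtype.ext (hz.eq_of_inf_eq hz' (h.symm.trans h') heq)
  · rintro l ⟨⟨hal, hly, hl⟩, hne⟩
    obtain ⟨hz, h₁, h₂⟩ := IsCloser.of_sup x.2 hbase (le_inf inf_le_left hw.base_le) inf_le_left
      hw.finrank_inf_left hal hly (by omega)
    refine ⟨⟨_, hz.finrank_eq⟩, ⟨hz, h₁.symm, fun h' => hne ?_⟩, h₂⟩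
    exact h₂.symm.trans (congrArg (· ⊓ y.1) h'.symm)

end Edges

lemma cast_eq_mul_gaussQ {q i N : ℕ} (hq : 1 < q) (hi : 0 < i)
    (h : N + 1 = ∑ j ∈ Finset.range i, q ^ j) : (N : ℚ) = (q : ℚ) * gaussQ q (i - 1) := by
  obtain ⟨m, rfl⟩ := Nat.exists_eq_add_of_le' hi
  have hq' : (q : ℚ) ≠ 1 := by exact_mod_cast hq.ne'
  rw [Finset.sum_range_succ', pow_zero, Nat.add_right_cancel_iff] at h
  rw [h, Nat.add_sub_cancel, gaussQ, ← geom_sum_eq hq', Finset.mul_sum]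
  push_cast
  exact Finset.sum_congr rfl fun j _ => pow_succ' _ _

theorem statement9
    (q n k : ℕ) (hq : IsPrimePow q) (hkn : 2 * k < n) (hk : 3 ≤ k)
    (F V : Type) [Field F] [Fintype F] (hcard : Fintype.card F = q)
    [AddCommGroup V] [Module F V] [FiniteDimensional F V]
    (hdim : Module.finrank F V = n)
    [Fintype (Submodule F V)]
    (x y : GrassVertex F V k)
    (i : ℕ) (hi : (Grass F V k).dist x y = i) (hi1 : 1 < i) (hi2 : i < k)
    (w : GrassVertex F V k) (hw : w ∈ Cset x y) :
    {z | z ∈ Cset x y ∧ (Grass F V k).Adj w z ∧ EdgeType0 y w z} = (∅ : Set (GrassVertex F V k)) ∧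
    ({z | z ∈ Cset x y ∧ (Grass F V k).Adj w z ∧ EdgeTypeP y w z}.ncard : ℚ) = (q : ℚ) * gaussQ q (i - 1) ∧
    ({z | z ∈ Cset x y ∧ (Grass F V k).Adj w z ∧ EdgeTypeM y w z}.ncard : ℚ) = (q : ℚ) * gaussQ q (i - 1) := by
  have hk0 : 0 < k := by omega
  have hi0 : 0 < i := by omega
  have hq1 : 1 < q := hq.one_lt
  have hc : Nat.card F = q := by rw [Nat.card_eq_fintype_card, hcard]
  have hw' := (mem_Cset_iff hk0 hi0 hi).1 hw
  refine ⟨?_, ?_, ?_⟩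
  · refine Set.eq_empty_of_forall_notMem ?_
    rintro z ⟨hz, hadj, h0⟩
    exact not_edgeType0 hk0 hw' ((mem_Cset_iff hk0 hi0 hi).1 hz) hadj h0
  · exact cast_eq_mul_gaussQ hq1 hi0 (hc ▸ ncard_edgeTypeP hk0 hi0 hi hw')
  · exact cast_eq_mul_gaussQ hq1 hi0 (hc ▸ ncard_edgeTypeM hk0 hi0 hi hw')
end
end

section
/- For every w ∈ A_xy, the (w,x)-entry of the matrix product F+·F− equals 0. -/
open scoped Classical

noncomputable section

variable {F V : Type} [Field F] [AddCommGroup V] [Module F V]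

/-- If `w` and `x` are `k`-dimensional and meet in dimension `k - 1`, no subspace is both a
`+`-neighbour of `w` and a `-`-neighbour of `x`. -/
lemma not_backslashCovers_and_slashCovers [FiniteDimensional F V] {k : ℕ}
    {w x y v : Submodule F V} (hw : Module.finrank F ↥w = k) (hx : Module.finrank F ↥x = k)
    (hwx : Module.finrank F ↥(x ⊓ w) + 1 = k)
    (hpw : BackslashCovers y w (w ⊔ v)) (hpv : BackslashCovers y v (w ⊔ v))
    (hmv : SlashCovers y (v ⊓ x) v) (hmx : SlashCovers y (v ⊓ x) x) : False := by
  obtain ⟨⟨-, hw1⟩, hwy⟩ := hpw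
  obtain ⟨⟨-, hv1⟩, hvy⟩ := hpv
  obtain ⟨⟨-, hvx⟩, hvxy⟩ := hmv
  obtain ⟨⟨-, hxv⟩, hxy⟩ := hmx
  have hw_eq : w ⊓ y = (w ⊔ v) ⊓ y :=
    Submodule.eq_of_le_of_finrank_eq (inf_le_inf_right y le_sup_left) hwy.symm
  have hv_eq : v ⊓ y = (w ⊔ v) ⊓ y :=
    Submodule.eq_of_le_of_finrank_eq (inf_le_inf_right y le_sup_right) hvy.symm
  have hle : ¬ x ≤ w ⊔ v := by
    intro h
    have h1 : x ⊓ y ≤ v ⊓ y := (inf_le_inf_right y h).trans hv_eq.ge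
    have h2 : x ⊓ y ≤ v ⊓ x ⊓ y := le_inf (le_inf (h1.trans inf_le_left) inf_le_left) inf_le_right
    have := Submodule.finrank_mono h2
    omega
  have hlt : Module.finrank F ↥(x ⊓ (w ⊔ v)) < Module.finrank F ↥x :=
    Submodule.finrank_lt_finrank_of_lt (inf_lt_left.2 hle)
  have hvx_eq : v ⊓ x = x ⊓ (w ⊔ v) :=
    Submodule.eq_of_le_of_finrank_le (le_inf inf_le_right (inf_le_left.trans le_sup_right))
      (by omega)
  have hxw_eq : x ⊓ w = x ⊓ (w ⊔ v) :=
    Submodule.eq_of_le_of_finrank_le (inf_le_inf_left x le_sup_left) (by omega)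
  have hwv : Module.finrank F ↥(w ⊔ v) + Module.finrank F ↥(w ⊓ v) =
      Module.finrank F ↥w + Module.finrank F ↥v := Submodule.finrank_sup_add_finrank_inf_eq w v
  have hinf_eq : v ⊓ x = w ⊓ v :=
    Submodule.eq_of_le_of_finrank_le
      (le_inf ((hvx_eq.trans hxw_eq.symm).le.trans inf_le_right) inf_le_left) (by omega)
  have hvy_le : v ⊓ y ≤ v ⊓ x ⊓ y :=
    le_inf (hinf_eq ▸ le_inf ((hv_eq.trans hw_eq.symm).le.trans inf_le_left) inf_le_left)
      inf_le_right
  have := Submodule.finrank_mono hvy_le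
  omega

theorem statement10
    (q n k : ℕ) (hq : IsPrimePow q) (hkn : 2 * k < n) (hk : 3 ≤ k)
    (F V : Type) [Field F] [Fintype F] (hcard : Fintype.card F = q)
    [AddCommGroup V] [Module F V] [FiniteDimensional F V]
    (hdim : Module.finrank F V = n)
    [Fintype (Submodule F V)]
    (x y : GrassVertex F V k)
    (i : ℕ) (hi : (Grass F V k).dist x y = i) (hi1 : 1 < i) (hi2 : i < k) :
    ∀ w ∈ Aset x y, (matFp y.1 * matFm y.1) w.1 x.1 = 0 := by
  rintro w ⟨hadj, -⟩
  have hwx : Module.finrank F ↥(x.1 ⊓ w.1) = k - 1 := by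
    obtain ⟨-, h | h⟩ := (SimpleGraph.fromRel_adj _ _ _).1 hadj
    · exact h
    · rwa [inf_comm]
  rw [Matrix.mul_apply]
  refine Finset.sum_eq_zero fun v _ => ?_
  simp only [matFp, matFm, Matrix.of_apply, mul_eq_zero, ite_eq_right_iff, one_ne_zero, imp_false]
  by_contra! h
  exact not_backslashCovers_and_slashCovers w.2 x.2 (by omega) h.1.1 h.1.2 h.2.1 h.2.2
end
end

section
/- The following hold: (i) for every w ∈ A_xy the (w,x)-entry of F−·F+ equals 0; (ii) if w ∈ A+_xy then the (w,x)-entry of F0·F− equals 0; (iii) if w ∈ A+_xy then the (w,x)-entry of F−·F0 equals 0; (iv) if w ∈ A+_xy then the (w,x)-entry of (F−)² equals 0; (v) if w ∈ A−_xy then the (w,x)-entry of F0·F+ equals 0; (vi) if w ∈ A−_xy then the (w,x)-entry of F+·F0 equals 0; (vii) if w ∈ A−_xy then the (w,x)-entry of (F+)² equals 0. -/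
open scoped Classical

noncomputable section

variable {F V : Type} [Field F] [AddCommGroup V] [Module F V]

section CoveringRelations

variable {y u v : Submodule F V}

lemma inf_ne_of_slashCovers_inf (h : SlashCovers y (u ⊓ v) u) : u ⊓ y ≠ v ⊓ y := by
  intro e
  have h₂ := h.2
  rw [inf_assoc, ← e, ← inf_assoc, inf_idem] at h₂
  omega

lemma inf_ne_of_matFm_ne_zero (h : matFm y u v ≠ 0) : u ⊓ y ≠ v ⊓ y := by
  have hc : SlashCovers y (u ⊓ v) u ∧ SlashCovers y (u ⊓ v) v := by
    simpa [matFm] using h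
  exact inf_ne_of_slashCovers_inf hc.1

lemma finrank_inf_eq_of_matFm_ne_zero (h : matFm y u v ≠ 0) :
    Module.finrank F ↥(u ⊓ y) = Module.finrank F ↥(v ⊓ y) := by
  obtain ⟨hu, hv⟩ : SlashCovers y (u ⊓ v) u ∧ SlashCovers y (u ⊓ v) v := by
    simpa [matFm] using h
  exact hu.2.trans hv.2.symm

variable [FiniteDimensional F V]

lemma BackslashCovers.inf_eq (h : BackslashCovers y u v) : u ⊓ y = v ⊓ y :=
  Submodule.eq_of_le_of_finrank_eq (inf_le_inf_right y h.1.1) h.2.symm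

lemma SlashCovers.sup_eq (h : SlashCovers y u v) : u ⊔ y = v ⊔ y := by
  apply Submodule.eq_of_le_of_finrank_eq (sup_le_sup_right h.1.1 y)
  have hu := Submodule.finrank_sup_add_finrank_inf_eq u y
  have hv := Submodule.finrank_sup_add_finrank_inf_eq v y
  have h₁ := h.1.2
  have h₂ := h.2
  omega

lemma BackslashCovers.sup_ne (h : BackslashCovers y u v) : u ⊔ y ≠ v ⊔ y := by
  intro e
  have hu := Submodule.finrank_sup_add_finrank_inf_eq u y
  have hv := Submodule.finrank_sup_add_finrank_inf_eq v y
  have h₁ := h.1.2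
  have h₂ := h.2
  rw [e] at hu
  omega

lemma inf_eq_of_matFp_ne_zero (h : matFp y u v ≠ 0) : u ⊓ y = v ⊓ y := by
  obtain ⟨hu, hv⟩ : BackslashCovers y u (u ⊔ v) ∧ BackslashCovers y v (u ⊔ v) := by
    simpa [matFp] using h
  exact hu.inf_eq.trans hv.inf_eq.symm

lemma sup_ne_of_backslashCovers_sup (h : BackslashCovers y u (u ⊔ v)) : u ⊔ y ≠ v ⊔ y := by
  intro e
  apply h.sup_ne
  rw [sup_assoc, ← e, ← sup_assoc, sup_idem]

lemma sup_ne_of_matFp_ne_zero (h : matFp y u v ≠ 0) : u ⊔ y ≠ v ⊔ y := by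
  have hc : BackslashCovers y u (u ⊔ v) ∧ BackslashCovers y v (u ⊔ v) := by
    simpa [matFp] using h
  exact sup_ne_of_backslashCovers_sup hc.1

lemma sup_eq_of_matFm_ne_zero (h : matFm y u v ≠ 0) : u ⊔ y = v ⊔ y := by
  obtain ⟨hu, hv⟩ : SlashCovers y (u ⊓ v) u ∧ SlashCovers y (u ⊓ v) v := by
    simpa [matFm] using h
  exact hu.sup_eq.symm.trans hv.sup_eq

lemma inf_eq_and_sup_eq_of_matF0_ne_zero (h : matF0 y u v ≠ 0) :
    u ⊓ y = v ⊓ y ∧ u ⊔ y = v ⊔ y := by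
  obtain ⟨hu, hv, hu', hv'⟩ : SlashCovers y u (u ⊔ v) ∧ SlashCovers y v (u ⊔ v) ∧
      BackslashCovers y (u ⊓ v) u ∧ BackslashCovers y (u ⊓ v) v := by
    simpa [matF0] using h
  exact ⟨hu'.inf_eq.symm.trans hv'.inf_eq, hu.sup_eq.trans hv.sup_eq.symm⟩

lemma le_sup_of_not_inf_le (hc : Module.finrank F u ≤ Module.finrank F ↥(u ⊓ v) + 1)
    (h : ¬ u ⊓ y ≤ v) : u ≤ v ⊔ y := by
  have hlt : u ⊓ v < (u ⊓ v) ⊔ (u ⊓ y) := by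
    refine lt_of_le_of_ne le_sup_left fun e => h ?_
    exact le_trans (le_trans le_sup_right e.ge) inf_le_right
  have hr := Submodule.finrank_lt_finrank_of_lt hlt
  have he : (u ⊓ v) ⊔ (u ⊓ y) = u :=
    Submodule.eq_of_le_of_finrank_le (sup_le inf_le_left inf_le_left) (by omega)
  calc u = (u ⊓ v) ⊔ (u ⊓ y) := he.symm
    _ ≤ v ⊔ y := sup_le_sup inf_le_right inf_le_right

lemma sup_le_sup_of_inf_ne (hc : Module.finrank F u ≤ Module.finrank F ↥(u ⊓ v) + 1)
    (hr : Module.finrank F ↥(u ⊓ y) = Module.finrank F ↥(v ⊓ y))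
    (h : u ⊓ y ≠ v ⊓ y) : u ⊔ y ≤ v ⊔ y := by
  refine sup_le (le_sup_of_not_inf_le hc fun hle => h ?_) le_sup_right
  exact Submodule.eq_of_le_of_finrank_eq (le_inf hle inf_le_right) hr

/-- If `u` and `v` meet in codimension at most one and `u ⊓ y`, `v ⊓ y` are distinct of the same
dimension, then `u` and `v` have the same span with `y`. -/
lemma sup_eq_sup_of_inf_ne (hu : Module.finrank F u ≤ Module.finrank F ↥(u ⊓ v) + 1)
    (hv : Module.finrank F v ≤ Module.finrank F ↥(u ⊓ v) + 1)
    (hr : Module.finrank F ↥(u ⊓ y) = Module.finrank F ↥(v ⊓ y))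
    (h : u ⊓ y ≠ v ⊓ y) : u ⊔ y = v ⊔ y :=
  le_antisymm (sup_le_sup_of_inf_ne hu hr h)
    (sup_le_sup_of_inf_ne (inf_comm u v ▸ hv) hr.symm h.symm)

end CoveringRelations

lemma Grass.Adj.finrank_inf {k : ℕ} {a b : GrassVertex F V k} (h : (Grass F V k).Adj a b) :
    Module.finrank F ↥(a.1 ⊓ b.1) = k - 1 := by
  rw [Grass, SimpleGraph.fromRel_adj] at h
  rcases h.2 with h | h
  · exact h
  · rwa [inf_comm]

lemma Matrix.mul_apply_eq_zero_of_forall {ι : Type*} [Fintype ι] {A B : Matrix ι ι ℂ} {a b : ι}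
    (h : ∀ c, A a c ≠ 0 → B c b ≠ 0 → False) : (A * B) a b = 0 := by
  rw [Matrix.mul_apply]
  refine Finset.sum_eq_zero fun c _ => ?_
  by_contra hc
  exact h c (left_ne_zero_of_mul hc) (right_ne_zero_of_mul hc)

theorem statement11
    (q n k : ℕ) (hq : IsPrimePow q) (hkn : 2 * k < n) (hk : 3 ≤ k)
    (F V : Type) [Field F] [Fintype F] (hcard : Fintype.card F = q)
    [AddCommGroup V] [Module F V] [FiniteDimensional F V]
    (hdim : Module.finrank F V = n)
    [Fintype (Submodule F V)]
    (x y : GrassVertex F V k)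
    (i : ℕ) (hi : (Grass F V k).dist x y = i) (hi1 : 1 < i) (hi2 : i < k) :
    (∀ w ∈ Aset x y, (matFm y.1 * matFp y.1) w.1 x.1 = 0) ∧
    (∀ w ∈ Apset x y, (matF0 y.1 * matFm y.1) w.1 x.1 = 0) ∧
    (∀ w ∈ Apset x y, (matFm y.1 * matF0 y.1) w.1 x.1 = 0) ∧
    (∀ w ∈ Apset x y, (matFm y.1 * matFm y.1) w.1 x.1 = 0) ∧
    (∀ w ∈ Amset x y, (matF0 y.1 * matFp y.1) w.1 x.1 = 0) ∧
    (∀ w ∈ Amset x y, (matFp y.1 * matF0 y.1) w.1 x.1 = 0) ∧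
    (∀ w ∈ Amset x y, (matFp y.1 * matFp y.1) w.1 x.1 = 0) := by
  refine ⟨fun w hw => ?_, fun w hw => ?_, fun w hw => ?_, fun w hw => ?_, fun w hw => ?_,
    fun w hw => ?_, fun w hw => ?_⟩ <;>
    refine Matrix.mul_apply_eq_zero_of_forall fun z hwz hzx => ?_
  · have hinf := inf_eq_of_matFp_ne_zero hzx
    have hr := Grass.Adj.finrank_inf hw.1
    rw [inf_comm] at hr
    have hx := x.2
    have hw' := w.2
    refine sup_ne_of_matFp_ne_zero hzx ((sup_eq_of_matFm_ne_zero hwz).symm.trans ?_)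
    refine sup_eq_sup_of_inf_ne (by omega) (by omega) ?_ ?_
    · rw [← hinf]
      exact finrank_inf_eq_of_matFm_ne_zero hwz
    · rw [← hinf]
      exact inf_ne_of_matFm_ne_zero hwz
  · exact sup_ne_of_backslashCovers_sup hw.2.1
      ((inf_eq_and_sup_eq_of_matF0_ne_zero hwz).2.trans (sup_eq_of_matFm_ne_zero hzx))
  · exact sup_ne_of_backslashCovers_sup hw.2.1
      ((sup_eq_of_matFm_ne_zero hwz).trans (inf_eq_and_sup_eq_of_matF0_ne_zero hzx).2)
  · exact sup_ne_of_backslashCovers_sup hw.2.1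
      ((sup_eq_of_matFm_ne_zero hwz).trans (sup_eq_of_matFm_ne_zero hzx))
  · exact inf_ne_of_slashCovers_inf hw.2.1
      ((inf_eq_and_sup_eq_of_matF0_ne_zero hwz).1.trans (inf_eq_of_matFp_ne_zero hzx))
  · exact inf_ne_of_slashCovers_inf hw.2.1
      ((inf_eq_of_matFp_ne_zero hwz).trans (inf_eq_and_sup_eq_of_matF0_ne_zero hzx).1)
  · exact inf_ne_of_slashCovers_inf hw.2.1
      ((inf_eq_of_matFp_ne_zero hwz).trans (inf_eq_of_matFp_ne_zero hzx))
end
end
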